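/- Let p be a probability mass function on X_N, let G=(N,E) be a DAG with topological ordering O, let A ⊆ roots(G), and let H=(N, E ∪ E_A) where E_A={(s,t): s,t∈A, O(s)<O(t)}. If there exists a conditional system for N∖A given A that factorizes over G and is a version of the conditional distribution of p, then p factorizes over H, i.e. p ∈ P^H. -/

import Mathlib

open Finset

/-! Basic graph-theoretic definitions for Bayesian networks. -/

/-- Two nodes are joined (adjacent) in the directed graph `E`. -/
def GJoined {V : Type*} (E : V → V → Prop) (a b : V) : Prop := E a b ∨ E b a

/-- A directed graph (given by its edge relation) is a DAG iff it has no cycles: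
no node can reach itself by a nonempty directed walk. -/
def IsDAG {V : Type*} (E : V → V → Prop) : Prop := ∀ s, ¬ Relation.TransGen E s s

/-- The set of parents of `s`. -/
def paG {V : Type*} (E : V → V → Prop) (s : V) : Set V := {t | E t s}

/-- The set of children of `s`. -/
def chG {V : Type*} (E : V → V → Prop) (s : V) : Set V := {t | E s t}

/-- The set of descendants of `s` (nodes reachable from `s` by a nonempty directed path). -/
def desG {V : Type*} (E : V → V → Prop) (s : V) : Set V := {t | Relation.TransGen E s t}

/-- A set of nodes is complete if all pairs of distinct elements are joined. -/
def GComplete {V : Type*} (E : V → V → Prop) (S : Set V) : Prop :=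
  ∀ a ∈ S, ∀ b ∈ S, a ≠ b → GJoined E a b

/-- A directed graph is perfect if the parent set of every node is complete. -/
def GPerfect {V : Type*} (E : V → V → Prop) : Prop := ∀ s, GComplete E (paG E s)

/-- `a` and `b` are joined in the moral graph `G^M` of `E`:
either joined in `E` or distinct common parents of some node. -/
def MoralEdge {V : Type*} (E : V → V → Prop) (a b : V) : Prop :=
  E a b ∨ E b a ∨ (a ≠ b ∧ ∃ s, E a s ∧ E b s)

/-- A topological ordering of a graph on a finite node set: an injective map into
`{1, …, |N|}` (encoded as `Fin (card V)`) increasing along edges. -/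
def IsTopo {V : Type*} [Fintype V] (E : V → V → Prop) (O : V → Fin (Fintype.card V)) : Prop :=
  Function.Injective O ∧ ∀ s t, E s t → O s < O t

/-! d-separation. -/

/-- `u` is a v-structure (collider) of the trail `l` in the graph `E`. -/
def VStruct {V : Type*} (E : V → V → Prop) (l : List V) (u : V) : Prop :=
  ∃ l₁ l₂ a b, l = l₁ ++ a :: u :: b :: l₂ ∧ E a u ∧ E b u

/-- `l` is a trail in the graph `E`: a nonempty sequence of distinct nodes consecutively joined. -/
def IsTrail {V : Type*} (E : V → V → Prop) (l : List V) : Prop :=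
  l ≠ [] ∧ l.Nodup ∧ l.Chain' (GJoined E)

/-- The trail `l` is blocked by `S`. -/
def BlockedBy {V : Type*} (E : V → V → Prop) (S : Set V) (l : List V) : Prop :=
  ∃ u ∈ l, (u ∈ S ∧ ¬ VStruct E l u) ∨
    (VStruct E l u ∧ u ∉ S ∧ ∀ t ∈ desG E u, t ∉ S)

/-- d-separation: every trail from a node of `A` to a node of `B` is blocked by `S`. -/
def DSep {V : Type*} (E : V → V → Prop) (A B S : Set V) : Prop :=
  ∀ (l : List V) (a b : V), IsTrail E l → l.head? = some a → l.getLast? = some b →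
    a ∈ A → b ∈ B → BlockedBy E S l

/-- The set of leaves (childless nodes), as a `Finset`. -/
def leavesF {V : Type*} [Fintype V] (E : V → V → Prop) [DecidableRel E] : Finset V :=
  Finset.univ.filter fun s => ∀ t, ¬ E s t

/-! Probability on graphs (finite state spaces, pmfs). -/

section Prob

variable {V : Type*} [Fintype V] [DecidableEq V]
variable (X : V → Type*) [∀ v, Fintype (X v)]

/-- `p` is a probability mass function on `X_N = ∏ v, X v`. -/
def IsPMF (p : (∀ v, X v) → ℝ) : Prop :=
  (∀ x, 0 ≤ p x) ∧ ∑ x, p x = 1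

/-- `k` is a kernel function for the node `s` w.r.t. the graph `E`: it is nonnegative,
depends on the configuration only through the parents of `s` in `E`, and is normalized. -/
def IsKernel (E : V → V → Prop) (s : V) (k : X s → (∀ v, X v) → ℝ) : Prop :=
  (∀ a x, 0 ≤ k a x) ∧
  (∀ a x y, (∀ t, E t s → x t = y t) → k a x = k a y) ∧
  (∀ x, ∑ a, k a x = 1)

/-- `p` factorizes over the graph `E`: it is a product of kernel functions, one per node. -/
def Factorizes (E : V → V → Prop) (p : (∀ v, X v) → ℝ) : Prop :=
  ∃ k : ∀ s, X s → (∀ v, X v) → ℝ,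
    (∀ s, IsKernel X E s (k s)) ∧ ∀ x, p x = ∏ s, k s (x s) x

variable [∀ v, DecidableEq (X v)]

/-- The marginal of `p` on the coordinates in `C`, evaluated at (the `C`-part of) `x`. -/
def marg (p : (∀ v, X v) → ℝ) (C : Finset V) (x : ∀ v, X v) : ℝ :=
  ∑ y, if ∀ v ∈ C, y v = x v then p y else 0

/-- Conditional independence `A ⟂⟂ B ∣ S` w.r.t. the pmf `p`. -/
def CondIndep (p : (∀ v, X v) → ℝ) (A B S : Finset V) : Prop :=
  ∀ x, 0 < marg X p S x →
    marg X p (A ∪ B ∪ S) x * marg X p S x = marg X p (A ∪ S) x * marg X p (B ∪ S) x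

/-- `q` is a conditional system for `N ∖ A` given `A`: a family of pmfs on `X_{N∖A}`,
one for every configuration on `A`.  Here `q x` encodes `q(x_{N∖A} ∣ x_A)`. -/
def IsCondSystem (A : Finset V) (q : (∀ v, X v) → ℝ) : Prop :=
  (∀ x, 0 ≤ q x) ∧ ∀ x : ∀ v, X v, (∑ y, if ∀ v ∈ A, y v = x v then q y else 0) = 1

/-- The conditional system `q` for `N ∖ A` given `A` factorizes over the graph `E`. -/
def CondFactorizes (E : V → V → Prop) (A : Finset V) (q : (∀ v, X v) → ℝ) : Prop :=
  ∃ k : ∀ s, X s → (∀ v, X v) → ℝ,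
    (∀ s ∉ A, IsKernel X E s (k s)) ∧ ∀ x, q x = ∏ s ∈ Finset.univ \ A, k s (x s) x

/-- The conditional system `q` for `N ∖ A` given `A` is a version of the conditional
distribution of the pmf `p`. -/
def IsVersionOf (A : Finset V) (q p : (∀ v, X v) → ℝ) : Prop :=
  ∀ x, p x = q x * marg X p A x

/-- `G'` (edges `E'`) satisfies Goal I for `G` (edges `E`): `roots(G') ⊇ leaves(G)` and for
every pmf factorizing over `G` there is a conditional system for `N ∖ leaves(G)` given
`leaves(G)` factorizing over `G'` which is a version of its conditional distribution. -/
def GoalI (E E' : V → V → Prop) [DecidableRel E] : Prop :=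
  (∀ s ∈ leavesF E, ∀ t, ¬ E' t s) ∧
  ∀ p : (∀ v, X v) → ℝ, IsPMF X p → Factorizes X E p →
    ∃ q, IsCondSystem X (leavesF E) q ∧ CondFactorizes X E' (leavesF E) q ∧
      IsVersionOf X (leavesF E) q p

/-- `G'` (edges `E'`) satisfies Goal II for `G` (edges `E`): `P^{G'} ⊇ P^G` and every parent
in `G'` of a leaf of `G` is itself a leaf of `G`. -/
def GoalII (E E' : V → V → Prop) : Prop :=
  (∀ p : (∀ v, X v) → ℝ, IsPMF X p → Factorizes X E p → Factorizes X E' p) ∧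
  ∀ s t, (∀ u, ¬ E s u) → E' t s → ∀ u, ¬ E t u

end Prob

theorem IsKernel.mono {V : Type*} {X : V → Type*} [∀ v, Fintype (X v)]
    {E E' : V → V → Prop} {s : V} {k : X s → (∀ v, X v) → ℝ}
    (hk : IsKernel X E s k) (h : ∀ t, E t s → E' t s) : IsKernel X E' s k :=
  ⟨hk.1, fun a x y hxy => hk.2.1 a x y fun t ht => hxy t (h t ht), hk.2.2⟩

section Marginals

variable {V : Type*} [Fintype V] [DecidableEq V]
  {X : V → Type*} [∀ v, Fintype (X v)] [∀ v, DecidableEq (X v)]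
  {p : (∀ v, X v) → ℝ}

theorem marg_congr {C : Finset V} {x y : ∀ v, X v} (h : ∀ v ∈ C, x v = y v) :
    marg X p C x = marg X p C y := by
  unfold marg
  refine Finset.sum_congr rfl fun z _ => ?_
  have : (∀ v ∈ C, z v = x v) ↔ ∀ v ∈ C, z v = y v :=
    forall₂_congr fun v hv => by rw [h v hv]
  simp only [this]

theorem marg_empty (x : ∀ v, X v) : marg X p ∅ x = ∑ y, p y := by
  simp [marg]

theorem marg_nonneg (hp : ∀ x, 0 ≤ p x) (C : Finset V) (x : ∀ v, X v) : 0 ≤ marg X p C x :=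
  Finset.sum_nonneg fun y _ => by split_ifs <;> simp [hp y]

theorem sum_marg_insert_update {C : Finset V} {s : V} (hs : s ∉ C) (x : ∀ v, X v) :
    ∑ a, marg X p (insert s C) (Function.update x s a) = marg X p C x := by
  unfold marg
  rw [Finset.sum_comm]
  refine Finset.sum_congr rfl fun y _ => ?_
  have hC (a : X s) : (∀ v ∈ insert s C, y v = Function.update x s a v) ↔
      y s = a ∧ ∀ v ∈ C, y v = x v := by
    rw [Finset.forall_mem_insert, Function.update_self]
    refine and_congr_right fun _ => forall₂_congr fun v hv => ?_
    rw [Function.update_of_ne (ne_of_mem_of_not_mem hv hs)]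
  simp only [hC, ite_and, Finset.sum_ite_eq, Finset.mem_univ, if_true]

variable (p) in
/-- The conditional probability of `a` at the node `s` given the coordinates in `C`, taken to be
uniform where the conditioning event is null. -/
noncomputable def condKernel (C : Finset V) (s : V) (a : X s) (x : ∀ v, X v) : ℝ :=
  if marg X p C x = 0 then (Fintype.card (X s) : ℝ)⁻¹
  else marg X p (insert s C) (Function.update x s a) / marg X p C x

theorem isKernel_condKernel [∀ v, Nonempty (X v)] (hp : ∀ x, 0 ≤ p x) {E : V → V → Prop}
    {C : Finset V} {s : V} (hs : s ∉ C) (hC : ∀ t ∈ C, E t s) :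
    IsKernel X E s (condKernel p C s) := by
  refine ⟨fun a x => ?_, fun a x y hxy => ?_, fun x => ?_⟩
  · unfold condKernel
    split_ifs
    · positivity
    · exact div_nonneg (marg_nonneg hp _ _) (marg_nonneg hp _ _)
  · have hxy' : ∀ v ∈ C, x v = y v := fun v hv => hxy v (hC v hv)
    unfold condKernel
    rw [marg_congr hxy', marg_congr (x := Function.update x s a) (y := Function.update y s a)]
    rw [Finset.forall_mem_insert]
    refine ⟨by simp, fun v hv => ?_⟩
    have hvs := ne_of_mem_of_not_mem hv hs
    rw [Function.update_of_ne hvs, Function.update_of_ne hvs, hxy' v hv]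
  · unfold condKernel
    split_ifs with h0
    · simp
    · rw [← Finset.sum_div, sum_marg_insert_update hs, div_self h0]

theorem condKernel_mul_marg (hp : ∀ x, 0 ≤ p x) {C : Finset V} {s : V} (hs : s ∉ C)
    (x : ∀ v, X v) :
    condKernel p C s (x s) x * marg X p C x = marg X p (insert s C) x := by
  unfold condKernel
  split_ifs with h0
  · rw [h0, mul_zero]
    have hsum := sum_marg_insert_update (p := p) hs x
    rw [h0, Finset.sum_eq_zero_iff_of_nonneg fun a _ => marg_nonneg hp _ _] at hsum
    simpa using (hsum (x s) (Finset.mem_univ _)).symm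
  · rw [div_mul_cancel₀ _ h0, Function.update_eq_self]

/-- The chain rule along an injective ordering of the nodes. -/
theorem prod_condKernel {ι : Type*} [LinearOrder ι] {O : V → ι} (hO : Function.Injective O)
    (hp : IsPMF X p) (B : Finset V) (x : ∀ v, X v) :
    ∏ s ∈ B, condKernel p (B.filter fun t => O t < O s) s (x s) x = marg X p B x := by
  induction B using Finset.induction_on_max_value O with
  | empty => rw [Finset.prod_empty, marg_empty, hp.2]
  | insert a B ha hmax ih =>
    have hself : (insert a B).filter (fun t => O t < O a) = B := by
      rw [Finset.filter_insert, if_neg (lt_irrefl _), Finset.filter_eq_self]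
      exact fun t ht => (hmax t ht).lt_of_ne (hO.ne (ne_of_mem_of_not_mem ht ha))
    have hB : ∀ s ∈ B, (insert a B).filter (fun t => O t < O s) =
        B.filter fun t => O t < O s := fun s hs => by
      rw [Finset.filter_insert, if_neg (hmax s hs).not_gt]
    rw [Finset.prod_insert ha, hself, Finset.prod_congr rfl fun s hs => by rw [hB s hs], ih,
      condKernel_mul_marg hp.1 ha]

end Marginals

/-- if a conditional system for `N ∖ A` given `A ⊆ roots(G)` factorizes over
`G` and is a version of the conditional distribution of `p`, then `p` factorizes over
`H = (N, E ∪ E_A)`, where `E_A` joins the nodes of `A` along the topological ordering `O`. -/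
theorem stmt4 {V : Type*} [Fintype V] [DecidableEq V] [Nonempty V]
    (X : V → Type*) [∀ v, Fintype (X v)] [∀ v, Nonempty (X v)] [∀ v, DecidableEq (X v)]
    (E : V → V → Prop) (hE : IsDAG E)
    (O : V → Fin (Fintype.card V)) (hO : IsTopo E O)
    (A : Finset V) (hA : ∀ s ∈ A, ∀ t, ¬ E t s)
    (p : (∀ v, X v) → ℝ) (hp : IsPMF X p)
    (h : ∃ q, IsCondSystem X A q ∧ CondFactorizes X E A q ∧ IsVersionOf X A q p) :
    Factorizes X (fun s t => E s t ∨ (s ∈ A ∧ t ∈ A ∧ O s < O t)) p := by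
  obtain ⟨q, -, ⟨k, hk, hq⟩, hqp⟩ := h
  refine ⟨fun s => if s ∈ A then condKernel p (A.filter fun t => O t < O s) s else k s,
    fun s => ?_, fun x => ?_⟩
  · dsimp only
    split_ifs with hs
    · exact isKernel_condKernel hp.1 (by simp) fun t ht =>
        Or.inr ⟨(Finset.mem_filter.1 ht).1, hs, (Finset.mem_filter.1 ht).2⟩
    · exact (hk s hs).mono fun t => Or.inl
  · rw [hqp x, hq x, ← prod_condKernel hO.1 hp A x, ← Finset.prod_sdiff (Finset.subset_univ A)]
    congr 1
    · exact Finset.prod_congr rfl fun s hs => by simp only [if_neg (Finset.mem_sdiff.1 hs).2]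
    · exact Finset.prod_congr rfl fun s hs => by simp only [if_pos hs]
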